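/- (Vanishing criterion R2.) Let g ∈ GSp6(k) and X = Sᵀ·g·S. Suppose there exists s ∈ S with g⁻¹·sᵀ·g ∈ S and ψ_Sᵀ(sᵀ) ≠ ψ_S(g⁻¹·sᵀ·g). Then every (S,ψ,T)-invariant distribution on X is zero. -/

import Mathlib

open Matrix Pointwise

/-- 2×2 matrices over `k`. -/
abbrev M2 (k : Type*) [Field k] := Matrix (Fin 2) (Fin 2) k

/-- 6×6 matrices over `k`. -/
abbrev M6 (k : Type*) [Field k] := Matrix (Fin 6) (Fin 6) k

variable {k : Type*} [Field k]

/-- The 2×2 matrix `J = [[0,-1],[1,0]]`. -/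
def Jmat : M2 k := !![0, -1; 1, 0]

/-- Build a 6×6 matrix from a 3×3 array of 2×2 blocks. -/
def blk (M : Fin 3 → Fin 3 → M2 k) : M6 k :=
  Matrix.of fun i j =>
    M ⟨i.val / 2, by have := i.isLt; omega⟩ ⟨j.val / 2, by have := j.isLt; omega⟩
      ⟨i.val % 2, by have := i.isLt; omega⟩ ⟨j.val % 2, by have := j.isLt; omega⟩

/-- Block diagonal 6×6 matrix with 2×2 blocks `g`, `h`, `m`. -/
def bdiag (g h m : M2 k) : M6 k := blk ![![g, 0, 0], ![0, h, 0], ![0, 0, m]]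

/-- The block upper unitriangular matrix `[[I,X,Z],[0,I,Y],[0,0,I]]`. -/
def Umat (X Y Z : M2 k) : M6 k := blk ![![1, X, Z], ![0, 1, Y], ![0, 0, 1]]

/-- The 6×6 matrix `J3` with 2×2 blocks `[[0,0,J],[0,J,0],[J,0,0]]`. -/
def J3 : M6 k := blk ![![0, 0, Jmat], ![0, Jmat, 0], ![Jmat, 0, 0]]

/-- The group of symplectic similitudes `GSp6(k)`, as a subset of the 6×6 matrices. -/
def GSp6 (k : Type*) [Field k] : Set (M6 k) :=
  {g | IsUnit g ∧ ∃ l : kˣ, g * J3 * gᵀ = (l : k) • (J3 : M6 k)}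

/-- The Levi subgroup `L3 = { blockdiag(g, h, det(g⁻¹h)·g) }`. -/
def L3 (k : Type*) [Field k] : Set (M6 k) :=
  {m | ∃ g h : M2 k, IsUnit g ∧ IsUnit h ∧ m = bdiag g h ((g⁻¹ * h).det • g)}

/-- The unipotent radical `U3`. -/
def U3 (k : Type*) [Field k] : Set (M6 k) :=
  {m | ∃ X Y Z : M2 k, X * Jmat + Jmat * Yᵀ = 0 ∧
    Z * Jmat + Jmat * Zᵀ = -(X * Jmat * Xᵀ) ∧ m = Umat X Y Z}

/-- The parabolic subgroup `Q3 = L3 · U3`. -/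
def Q3 (k : Type*) [Field k] : Set (M6 k) := L3 k * U3 k

/-- The diagonal embedding `Δ(g) = blockdiag(g,g,g)`. -/
def Dmat (g : M2 k) : M6 k := bdiag g g g

/-- The diagonal copy `Δ(GL2)` of `GL2` in `GSp6`. -/
def DeltaGL2 (k : Type*) [Field k] : Set (M6 k) := {m | ∃ g : M2 k, IsUnit g ∧ m = Dmat g}

/-- The embedding `η(g) = blockdiag(I, g, det(g)·I)`. -/
def etaMat (g : M2 k) : M6 k := bdiag 1 g (g.det • (1 : M2 k))

/-- The copy `η(GL2)` of `GL2` in `GSp6`. -/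
def etaGL2 (k : Type*) [Field k] : Set (M6 k) := {m | ∃ g : M2 k, IsUnit g ∧ m = etaMat g}

/-- The Shalika subgroup `S = Δ(GL2) · U3`. -/
def Sgrp (k : Type*) [Field k] : Set (M6 k) := DeltaGL2 k * U3 k

/-- For a subset `H` of the 6×6 matrices, `Hᵀ = { hᵀ : h ∈ H }`. -/
def setT (H : Set (M6 k)) : Set (M6 k) := Matrix.transpose '' H

/-- The Weyl element `a = blockdiag(J, I, J)`. -/
def amat : M6 k := bdiag Jmat 1 Jmat

/-- The Weyl element `c = blockdiag(I, J, I)`. -/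
def cmat : M6 k := bdiag 1 Jmat 1

/-- The Weyl element `b`. -/
def bmat : M6 k :=
  !![1,0,0,0,0,0; 0,0,1,0,0,0; 0,-1,0,0,0,0; 0,0,0,0,1,0; 0,0,0,-1,0,0; 0,0,0,0,0,1]

/-- The set `Σ = {1, b, b·c·b, b·a·c·b, b·c·a·b·a·c·b}` of double coset representatives. -/
def SigmaSet (k : Type*) [Field k] : Set (M6 k) :=
  {1, bmat, bmat * cmat * bmat, bmat * amat * cmat * bmat,
    bmat * cmat * amat * bmat * amat * cmat * bmat}

/-- The space `C_c^∞(X)` of locally constant, compactly supported functions `X → ℂ`, for a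
subset `X` of the 6×6 matrices over a topological field. -/
def Cc {k : Type*} [Field k] [TopologicalSpace k] (X : Set (M6 k)) :
    Set ({m : M6 k // m ∈ X} → ℂ) :=
  {f | IsLocallyConstant f ∧ HasCompactSupport f}

/-- An `(S,ψ,T)`-invariant distribution on a subset `X ⊆ GSp6(k)` with `Sᵀ·X·S = X`: a
`ℂ`-linear functional `T` on `C_c^∞(X)` such that `T(x ↦ f(s⁻¹·x·t)) = ψ_Sᵀ(s)·ψ_S(t)⁻¹·T(f)`
for all `s ∈ Sᵀ` and `t ∈ S`.  (The values of `T` outside `C_c^∞(X)` are irrelevant.) -/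
def IsInvariantDistrib {k : Type*} [Field k] [TopologicalSpace k]
    (ψS : M6 k → ℂˣ) (X : Set (M6 k)) (T : ({m : M6 k // m ∈ X} → ℂ) → ℂ) : Prop :=
  (∀ f g, f ∈ Cc X → g ∈ Cc X → T (f + g) = T f + T g) ∧
  (∀ (c : ℂ) f, f ∈ Cc X → T (c • f) = c * T f) ∧
  (∀ s ∈ setT (Sgrp k), ∀ t ∈ Sgrp k, ∀ f f', f ∈ Cc X → f' ∈ Cc X →
    (∀ (x : M6 k) (hx : x ∈ X) (hx' : s⁻¹ * x * t ∈ X),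
      f' ⟨x, hx⟩ = f ⟨s⁻¹ * x * t, hx'⟩) →
    T f' = (ψS sᵀ : ℂ) * (ψS t : ℂ)⁻¹ * T f)

/-- The defining properties of the Shalika character `ψ_S` (extended arbitrarily to all 6×6
matrices; only its values on `S` matter): it is multiplicative on `S`, equals
`ψ_k(−tr X)` on `U3`, and equals `1` on `Δ(GL2)`. -/
def IsShalikaCharacter {k : Type*} [Field k] (ψk : k → ℂˣ) (ψS : M6 k → ℂˣ) : Prop :=
  (∀ x ∈ Sgrp k, ∀ y ∈ Sgrp k, ψS (x * y) = ψS x * ψS y) ∧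
  (∀ X Y Z : M2 k, X * Jmat + Jmat * Yᵀ = 0 →
    Z * Jmat + Jmat * Zᵀ = -(X * Jmat * Xᵀ) → ψS (Umat X Y Z) = ψk (-(X.trace))) ∧
  (∀ g : M2 k, IsUnit g → ψS (Dmat g) = 1)



section Abstract

open Topology

/-- van Dantzig: compact open subgroups form a basis at the identity. -/
theorem exists_compact_open_subgroup {G : Type*} [Group G] [TopologicalSpace G]
    [IsTopologicalGroup G] [LocallyCompactSpace G] [T2Space G] [TotallyDisconnectedSpace G]
    {U : Set G} (hU : U ∈ 𝓝 (1 : G)) :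
    ∃ K : Subgroup G, IsOpen (K : Set G) ∧ IsCompact (K : Set G) ∧ (K : Set G) ⊆ U := by
  obtain ⟨C, hC, hCU, hCc⟩ := LocallyCompactSpace.local_compact_nhds (1 : G) U hU
  obtain ⟨W, hW, h1W, hWC⟩ :=
    (loc_compact_Haus_tot_disc_of_zero_dim (H := G)).mem_nhds_iff.mp hC
  have hWc : IsCompact W := hCc.of_isClosed_subset hW.1 hWC
  obtain ⟨V, V', hV, hV', h1V, hWV', hVV'⟩ := generalized_tube_lemma
    (isCompact_singleton (x := (1 : G))) hWc (hW.2.preimage (continuous_mul (M := G)))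
    (by rintro ⟨a, b⟩ ⟨ha, hb⟩
        simp only [Set.mem_singleton_iff] at ha
        simpa [ha] using hb)
  have h1V : (1 : G) ∈ V := h1V rfl
  have key : ∀ a ∈ V, ∀ w ∈ W, a * w ∈ W := fun a ha w hw => hVV' (Set.mk_mem_prod ha (hWV' hw))
  let K : Subgroup G := MulAction.stabilizer G W
  have hKo : IsOpen (K : Set G) := by
    apply Subgroup.isOpen_of_mem_nhds (g := 1)
    have : V ∩ V⁻¹ ∈ 𝓝 (1 : G) :=
      Filter.inter_mem (hV.mem_nhds h1V) (hV.inv.mem_nhds (by simpa using h1V))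
    refine Filter.mem_of_superset this ?_
    rintro a ⟨ha, ha'⟩
    change a • W = W
    apply Set.Subset.antisymm
    · rintro _ ⟨w, hw, rfl⟩
      exact key a ha w hw
    · intro w hw
      rw [Set.mem_smul_set_iff_inv_smul_mem]
      exact key _ ha' w hw
  have hKW : (K : Set G) ⊆ W := by
    intro a ha
    have : a • W = W := ha
    rw [← this]
    exact ⟨1, h1W, by simp⟩
  refine ⟨K, hKo, hWc.of_isClosed_subset (K.isClosed_of_isOpen hKo) hKW, ?_⟩
  exact hKW.trans (hWC.trans hCU)

variable {G X : Type*} [Group G] [TopologicalSpace G] [IsTopologicalGroup G]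
  [TopologicalSpace X] [MulAction G X]

/-- Test functions. -/
def TestFn (X : Type*) [TopologicalSpace X] : Set (X → ℂ) :=
  {f | IsLocallyConstant f ∧ HasCompactSupport f}

theorem testFn_smul {f : X → ℂ} (hf : f ∈ TestFn X) (c : ℂ) : c • f ∈ TestFn X :=
  ⟨hf.1.comp (fun z => c * z), hf.2.comp_left (g := fun z => c * z) (by simp)⟩

theorem testFn_add {f g : X → ℂ} (hf : f ∈ TestFn X) (hg : g ∈ TestFn X) : f + g ∈ TestFn X :=
  ⟨hf.1.add hg.1, hf.2.add hg.2⟩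

theorem testFn_zero : (0 : X → ℂ) ∈ TestFn X :=
  ⟨IsLocallyConstant.const 0, HasCompactSupport.zero⟩

theorem testFn_sum {ι : Type*} (s : Finset ι) (φ : ι → X → ℂ) (hφ : ∀ i ∈ s, φ i ∈ TestFn X) :
    ∑ i ∈ s, φ i ∈ TestFn X := by
  classical
  induction s using Finset.induction_on with
  | empty => simpa using testFn_zero
  | insert a s ha ih =>
    rw [Finset.sum_insert ha]
    exact testFn_add (hφ a (by simp)) (ih fun i hi => hφ i (by simp [hi]))

theorem dist_sum {T : (X → ℂ) → ℂ}
    (hadd : ∀ f g, f ∈ TestFn X → g ∈ TestFn X → T (f + g) = T f + T g)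
    (hsmul : ∀ (c : ℂ) f, f ∈ TestFn X → T (c • f) = c * T f)
    {ι : Type*} (s : Finset ι) (φ : ι → X → ℂ) (hφ : ∀ i ∈ s, φ i ∈ TestFn X) :
    T (∑ i ∈ s, φ i) = ∑ i ∈ s, T (φ i) := by
  classical
  induction s using Finset.induction_on with
  | empty => simpa using hsmul 0 0 testFn_zero
  | insert a s ha ih =>
    rw [Finset.sum_insert ha, Finset.sum_insert ha, hadd _ _ (hφ a (by simp))
      (testFn_sum _ _ fun i hi => hφ i (by simp [hi])), ih fun i hi => hφ i (by simp [hi])]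

/-- Indicator function of a set. -/
noncomputable def ind (A : Set X) : X → ℂ := A.indicator 1

theorem ind_mem {A : Set X} [T2Space X] (hA : IsOpen A) (hA' : IsCompact A) :
    ind A ∈ TestFn X := by
  refine ⟨?_, ?_⟩
  · rw [IsLocallyConstant.iff_eventually_eq]
    intro x
    by_cases hx : x ∈ A
    · filter_upwards [hA.mem_nhds hx] with y hy
      simp [ind, hx, hy]
    · filter_upwards [hA'.isClosed.isOpen_compl.mem_nhds hx] with y hy
      have hy' : y ∉ A := hy
      simp [ind, hx, hy']
  · apply HasCompactSupport.of_support_subset_isCompact hA'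
    exact Set.support_indicator_subset

theorem ind_smul (g : G) (A : Set X) : (fun x => ind A (g⁻¹ • x)) = ind (g • A) := by
  funext x
  unfold ind
  by_cases h : x ∈ g • A
  · rw [Set.indicator_of_mem h, Set.indicator_of_mem (Set.mem_smul_set_iff_inv_smul_mem.mp h)]
    rfl
  · rw [Set.indicator_of_notMem h,
      Set.indicator_of_notMem (fun h' => h (Set.mem_smul_set_iff_inv_smul_mem.mpr h'))]

/-- The orbit of `x` under the subgroup `K`. -/
def orb (K : Subgroup G) (x : X) : Set X := (fun a : G => a • x) '' (K : Set G)

theorem dist_ratio [T2Space X] [ContinuousSMul G X]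
    (hopen : ∀ x : X, IsOpenMap (fun a : G => a • x))
    (χ : G →* ℂˣ) {T : (X → ℂ) → ℂ}
    (hadd : ∀ f g, f ∈ TestFn X → g ∈ TestFn X → T (f + g) = T f + T g)
    (hsmul : ∀ (c : ℂ) f, f ∈ TestFn X → T (c • f) = c * T f)
    (hinv : ∀ (a : G) f, f ∈ TestFn X → T (fun x => f (a⁻¹ • x)) = (χ a : ℂ) * T f)
    (K L : Subgroup G) (hK : IsOpen (K : Set G)) (hKc : IsCompact (K : Set G))
    (hL : IsOpen (L : Set G)) (hLc : IsCompact (L : Set G)) (hLK : L ≤ K)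
    (hχ : ∀ a ∈ K, χ a = 1) (x : X) :
    ∃ m n : ℕ, 0 < m ∧ 0 < n ∧ (m : ℂ) * T (ind (orb K x)) = n * T (ind (orb L x)) := by
  classical
  have hcont : Continuous (fun a : G => a • x) := by fun_prop
  have : CompactSpace K := isCompact_iff_compactSpace.mp hKc
  have : Finite (K ⧸ L.subgroupOf K) :=
    Subgroup.quotient_finite_of_isOpen _ (hL.preimage continuous_subtype_val)
  have : Fintype (K ⧸ L.subgroupOf K) := Fintype.ofFinite _
  let P : X → (K ⧸ L.subgroupOf K) → Prop := fun y q => ∃ a : K, (a : K ⧸ L.subgroupOf K) = q ∧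
    (a : G) • x = y
  let N : X → ℕ := fun y => (Finset.univ.filter (P y)).card
  have hPinv : ∀ (b : K) y q, P y q → P ((b : G) • y) (b • q) := by
    rintro b y q ⟨a, rfl, rfl⟩
    exact ⟨b * a, rfl, by simp [mul_smul]⟩
  have hN : ∀ (b : K) y, N y ≤ N ((b : G) • y) := by
    intro b y
    apply Finset.card_le_card_of_injOn (fun q => b • q)
    · intro q hq
      simp only [Finset.coe_filter, Finset.mem_univ, true_and, Set.mem_ofPred_eq] at hq ⊢
      exact hPinv b y q hq
    · exact (MulAction.injective b).injOn
  have hNK : ∀ b : K, N ((b : G) • x) = N x := by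
    intro b
    apply le_antisymm _ (hN b x)
    simpa using hN b⁻¹ ((b : G) • x)
  have hN0 : ∀ y, y ∉ orb K x → N y = 0 := by
    intro y hy
    rw [Finset.card_eq_zero, Finset.filter_eq_empty_iff]
    rintro q - ⟨a, -, rfl⟩
    exact hy ⟨a, a.2, rfl⟩
  have hNx : 0 < N x := by
    rw [Finset.card_pos]
    exact ⟨((1 : K) : K ⧸ L.subgroupOf K), by simpa using ⟨1, rfl, by simp⟩⟩
  have hset : ∀ a : K, {y | P y (a : K ⧸ L.subgroupOf K)} = (a : G) • orb L x := by
    intro a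
    ext y
    constructor
    · rintro ⟨b, hb, rfl⟩
      have := QuotientGroup.eq.mp hb.symm
      rw [Subgroup.mem_subgroupOf] at this
      refine ⟨_, ⟨_, this, rfl⟩, ?_⟩
      simp [smul_smul]
    · rintro ⟨_, ⟨l, hl, rfl⟩, rfl⟩
      refine ⟨a * ⟨l, hLK hl⟩, ?_, by simp [mul_smul]⟩
      symm
      rw [QuotientGroup.eq, Subgroup.mem_subgroupOf]
      simpa using hl
  have hLmem : ind (orb L x) ∈ TestFn X := ind_mem (hopen x _ hL) (hLc.image hcont)
  have hKmem : ind (orb K x) ∈ TestFn X := ind_mem (hopen x _ hK) (hKc.image hcont)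
  have hq : ∀ q : K ⧸ L.subgroupOf K, ind {y | P y q} ∈ TestFn X ∧
      T (ind {y | P y q}) = T (ind (orb L x)) := by
    intro q
    obtain ⟨a, rfl⟩ := QuotientGroup.mk_surjective q
    rw [hset]
    constructor
    · exact ind_mem ((hopen x _ hL).smul _) ((hLc.image hcont).smul _)
    · rw [← ind_smul, hinv _ _ hLmem, hχ _ a.2]
      simp
  have hfun : (N x : ℂ) • ind (orb K x) = ∑ q : K ⧸ L.subgroupOf K, ind {y | P y q} := by
    funext y
    have : (∑ q : K ⧸ L.subgroupOf K, ind {y | P y q}) y = N y := by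
      rw [Finset.sum_apply]
      simp [ind, Set.indicator_apply, N]
    rw [this]
    by_cases hy : y ∈ orb K x
    · obtain ⟨b, hb, rfl⟩ := id hy
      have := hNK ⟨b, hb⟩
      simp only at this
      simp [this, ind, hy]
    · simp [hN0 y hy, ind, hy]
  refine ⟨N x, Fintype.card (K ⧸ L.subgroupOf K), hNx, Fintype.card_pos, ?_⟩
  rw [← hsmul _ _ hKmem, hfun, dist_sum hadd hsmul _ _ fun q _ => (hq q).1,
    Finset.sum_congr rfl fun q _ => (hq q).2]
  simp

theorem abstract_vanishing [LocallyCompactSpace G] [T2Space G] [TotallyDisconnectedSpace G]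
    [SigmaCompactSpace G] [T2Space X] [ContinuousSMul G X] [MulAction.IsPretransitive G X]
    (χ : G →* ℂˣ) (hχ : ∀ᶠ a in 𝓝 (1 : G), χ a = 1) {T : (X → ℂ) → ℂ}
    (hadd : ∀ f g, f ∈ TestFn X → g ∈ TestFn X → T (f + g) = T f + T g)
    (hsmul : ∀ (c : ℂ) f, f ∈ TestFn X → T (c • f) = c * T f)
    (hinv : ∀ (a : G) f, f ∈ TestFn X → T (fun x => f (a⁻¹ • x)) = (χ a : ℂ) * T f)
    (x₀ : X) (h₀ : G) (hfix : h₀ • x₀ = x₀) (hne : χ h₀ ≠ 1) (hnorm : ‖(χ h₀ : ℂ)‖ = 1) :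
    ∀ f ∈ TestFn X, T f = 0 := by
  classical
  intro f hf
  by_cases hf0 : f = 0
  · subst hf0
    simpa using hsmul 0 0 testFn_zero
  -- `X` is locally compact
  obtain ⟨y, hy⟩ : ∃ y, f y ≠ 0 := by
    by_contra! h
    exact hf0 (funext h)
  have hysupp : tsupport f ∈ 𝓝 y := by
    refine Filter.mem_of_superset ((hf.1.isOpen_fiber (f y)).mem_nhds rfl) ?_
    intro z hz
    apply subset_tsupport
    change f z = f y at hz
    simpa [hz] using hy
  have : WeaklyLocallyCompactSpace X := by
    refine ⟨fun x => ?_⟩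
    obtain ⟨a, rfl⟩ := MulAction.exists_smul_eq G y x
    exact ⟨a • tsupport f, hf.2.isCompact.smul a, (smul_mem_nhds_smul_iff a).mpr hysupp⟩
  have hopen : ∀ x : X, IsOpenMap (fun a : G => a • x) := fun x => isOpenMap_smul_of_sigmaCompact x
  have hcont : ∀ x : X, Continuous (fun a : G => a • x) := fun x => by fun_prop
  -- vanishing on indicators of orbits
  have hvan : ∀ (K : Subgroup G), IsOpen (K : Set G) → IsCompact (K : Set G) →
      (∀ a ∈ K, χ a = 1) → ∀ x : X, T (ind (orb K x)) = 0 := by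
    intro K hK hKc hKχ x
    obtain ⟨a, rfl⟩ := MulAction.exists_smul_eq G x₀ x
    set x := a • x₀ with hx
    set h := a * h₀ * a⁻¹ with hh
    have hhx : h • x = x := by simp [hh, hx, mul_smul, hfix]
    have hχh : χ h = χ h₀ := by simp [hh, mul_comm]
    let K' : Subgroup G := K.map (MulAut.conj h).toMonoidHom
    have hK'set : (K' : Set G) = (fun b => h * b * h⁻¹) '' (K : Set G) := by
      ext b; simp [K']
    have hhomeo : (fun b => h * b * h⁻¹) =
        ((Homeomorph.mulLeft h).trans (Homeomorph.mulRight h⁻¹) : G ≃ₜ G) := by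
      ext b; simp
    have hK' : IsOpen (K' : Set G) := by
      rw [hK'set, hhomeo]; exact (Homeomorph.isOpenMap _) _ hK
    have hK'c : IsCompact (K' : Set G) := by
      rw [hK'set]; exact hKc.image (by fun_prop)
    have hK'χ : ∀ b ∈ K', χ b = 1 := by
      rintro _ ⟨b, hb, rfl⟩
      simp [hKχ b hb]
    have horb : h • orb K x = orb K' x := by
      ext z
      constructor
      · rintro ⟨_, ⟨b, hb, rfl⟩, rfl⟩
        refine ⟨h * b * h⁻¹, by rw [hK'set]; exact ⟨b, hb, rfl⟩, ?_⟩
        have : h⁻¹ • x = x := by rw [inv_smul_eq_iff, hhx]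
        simp [mul_smul, this]
      · intro hz
        obtain ⟨c, hc, rfl⟩ := hz
        rw [hK'set] at hc
        obtain ⟨b, hb, rfl⟩ := hc
        refine ⟨b • x, ⟨b, hb, rfl⟩, ?_⟩
        have : h⁻¹ • x = x := by rw [inv_smul_eq_iff, hhx]
        simp [mul_smul, this]
    have hmem : ind (orb K x) ∈ TestFn X := ind_mem (hopen x _ hK) (hKc.image (hcont x))
    have e1 : T (ind (orb K' x)) = (χ h₀ : ℂ) * T (ind (orb K x)) := by
      rw [← horb, ← ind_smul, hinv _ _ hmem, hχh]
    have hLo : IsOpen ((K ⊓ K' : Subgroup G) : Set G) := hK.inter hK'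
    have hLc : IsCompact ((K ⊓ K' : Subgroup G) : Set G) := hKc.inter hK'c
    obtain ⟨m, n, hm, hn, e2⟩ := dist_ratio hopen χ hadd hsmul hinv K (K ⊓ K') hK hKc hLo hLc
      inf_le_left hKχ x
    obtain ⟨m', n', hm', hn', e3⟩ := dist_ratio hopen χ hadd hsmul hinv K' (K ⊓ K') hK' hK'c
      hLo hLc inf_le_right hK'χ x
    by_contra hT0
    rw [e1] at e3
    have e4 : ((m' * n : ℕ) : ℂ) * (χ h₀ : ℂ) = ((m * n' : ℕ) : ℂ) := by
      apply mul_right_cancel₀ hT0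
      push_cast
      linear_combination (n : ℂ) * e3 - (n' : ℂ) * e2
    have e5 := congrArg norm e4
    rw [norm_mul, hnorm, mul_one, Complex.norm_natCast, Complex.norm_natCast] at e5
    have e6 : m' * n = m * n' := by exact_mod_cast e5
    rw [← e6] at e4
    apply hne
    have hpos : ((m' * n : ℕ) : ℂ) ≠ 0 := by
      have : 0 < m' * n := Nat.mul_pos hm' hn
      exact_mod_cast this.ne'
    apply Units.ext
    exact mul_left_cancel₀ hpos (by simpa using e4)
  -- smoothness of `f`
  obtain ⟨U, hU, hUf⟩ : ∃ U ∈ 𝓝 (1 : G), ∀ a ∈ U, ∀ x ∈ tsupport f, f (a • x) = f x := by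
    have hO : IsOpen {q : G × X | f (q.1 • q.2) = f q.2} := by
      have h1 : IsLocallyConstant (fun q : G × X => f (q.1 • q.2) - f q.2) :=
        (hf.1.comp_continuous continuous_smul).sub (hf.1.comp_continuous continuous_snd)
      have := h1.isOpen_fiber 0
      simpa only [sub_eq_zero] using this
    obtain ⟨V, V', hV, hV', h1V, hWV', hVV'⟩ := generalized_tube_lemma
      (isCompact_singleton (x := (1 : G))) hf.2.isCompact hO
      (by rintro ⟨a, b⟩ ⟨ha, hb⟩
          simp only [Set.mem_singleton_iff] at ha
          simp [ha])
    exact ⟨V, hV.mem_nhds (h1V rfl), fun a ha x hx => hVV' (Set.mk_mem_prod ha (hWV' hx))⟩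
  obtain ⟨K, hK, hKc, hKU⟩ := exists_compact_open_subgroup (Filter.inter_mem hU hχ)
  have hKf : ∀ a ∈ K, ∀ x, f (a • x) = f x := by
    intro a ha x
    by_cases hx : x ∈ tsupport f
    · exact hUf a (hKU ha).1 x hx
    · by_cases hx' : a • x ∈ tsupport f
      · have := hUf a⁻¹ (hKU (K.inv_mem ha)).1 _ hx'
        rw [inv_smul_smul] at this
        exact this.symm
      · rw [image_eq_zero_of_notMem_tsupport hx, image_eq_zero_of_notMem_tsupport hx']
  have hKχ : ∀ a ∈ K, χ a = 1 := fun a ha => (hKU ha).2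
  have hself : ∀ x : X, x ∈ orb K x := fun x => ⟨1, K.one_mem, by simp⟩
  -- decomposition in orbits
  let R : Setoid X := MulAction.orbitRel K X
  let π : X → Quotient R := Quotient.mk R
  have hπ : ∀ x z : X, z ∈ orb K x ↔ π z = π x := by
    intro x z
    rw [Quotient.eq, MulAction.orbitRel_apply]
    constructor
    · rintro ⟨a, ha, rfl⟩
      exact ⟨⟨a, ha⟩, rfl⟩
    · rintro ⟨a, rfl⟩
      exact ⟨a, a.2, rfl⟩
  obtain ⟨t, ht⟩ := hf.2.isCompact.elim_finite_subcover (fun x => orb K x)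
    (fun x => hopen x _ hK) (fun x _ => Set.mem_iUnion.mpr ⟨x, hself x⟩)
  let F : Finset (Quotient R) := t.image π
  have hdec : f = ∑ q ∈ F, f q.out • ind (orb K q.out) := by
    funext z
    have hterm : ∀ q : Quotient R, (f q.out • ind (orb K q.out)) z = if q = π z then f z else 0 := by
      intro q
      have hq : π q.out = q := Quotient.out_eq q
      have hi := hπ q.out z
      rw [hq] at hi
      by_cases h : q = π z
      · have hz := hi.mpr h.symm
        obtain ⟨a, ha, hz'⟩ := id hz
        have := hKf a ha q.out
        simp only at hz'
        rw [hz'] at this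
        rw [if_pos h, Pi.smul_apply, ind, Set.indicator_of_mem hz, this]
        simp
      · have hz : z ∉ orb K q.out := fun h' => h (hi.mp h').symm
        rw [if_neg h, Pi.smul_apply, ind, Set.indicator_of_notMem hz]
        simp
    rw [Finset.sum_apply, Finset.sum_congr rfl fun q _ => hterm q, Finset.sum_ite_eq']
    by_cases hz : π z ∈ F
    · rw [if_pos hz]
    · rw [if_neg hz]
      apply image_eq_zero_of_notMem_tsupport
      intro h
      obtain ⟨x, hx, hzx⟩ := Set.mem_iUnion₂.mp (ht h)
      exact hz (Finset.mem_image.mpr ⟨x, hx, ((hπ x z).mp hzx).symm⟩)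
  have hm : ∀ x : X, ind (orb K x) ∈ TestFn X := fun x =>
    ind_mem (hopen x _ hK) (hKc.image (hcont x))
  rw [hdec, dist_sum hadd hsmul _ _ fun q _ => testFn_smul (hm _) _]
  apply Finset.sum_eq_zero
  intro q _
  rw [hsmul _ _ (hm _), hvan K hK hKc hKχ, mul_zero]

end Abstract
section Concrete

open Topology

section Algebra
variable {k : Type*} [Field k]

theorem blk_mul (M N : Fin 3 → Fin 3 → M2 k) :
    blk M * blk N = blk (fun i j => ∑ l, M i l * N l j) := by
  ext i j
  simp only [blk, Matrix.mul_apply, Matrix.of_apply, Fin.sum_univ_six, Fin.sum_univ_three,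
    Matrix.add_apply, Fin.sum_univ_two]
  simp only [← add_assoc]
  rfl

theorem blk_transpose (M : Fin 3 → Fin 3 → M2 k) :
    (blk M)ᵀ = blk (fun i j => (M j i)ᵀ) := by
  ext i j
  simp [blk]

theorem blk_smul (c : k) (M : Fin 3 → Fin 3 → M2 k) :
    c • blk M = blk (fun i j => c • M i j) := by
  ext i j
  simp [blk]

/-- The `(i,j)` block of a 6×6 matrix. -/
def bl (m : M6 k) (i j : Fin 3) : M2 k := Matrix.of fun a b =>
  m ⟨2 * i.val + a.val, by omega⟩ ⟨2 * j.val + b.val, by omega⟩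

theorem bl_blk (M : Fin 3 → Fin 3 → M2 k) (i j : Fin 3) : bl (blk M) i j = M i j := by
  ext a b
  have h1 : ∀ (i : Fin 3) (a : Fin 2), (2 * i.val + a.val) / 2 = i.val := by intros; omega
  have h2 : ∀ (i : Fin 3) (a : Fin 2), (2 * i.val + a.val) % 2 = a.val := by intros; omega
  simp [bl, blk, h1, h2]

theorem blk_bl (m : M6 k) : blk (bl m) = m := by
  ext i j
  simp [bl, blk, Nat.div_add_mod]

theorem blk_inj {M N : Fin 3 → Fin 3 → M2 k} : blk M = blk N ↔
    (M 0 0 = N 0 0 ∧ M 0 1 = N 0 1 ∧ M 0 2 = N 0 2) ∧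
    (M 1 0 = N 1 0 ∧ M 1 1 = N 1 1 ∧ M 1 2 = N 1 2) ∧
    (M 2 0 = N 2 0 ∧ M 2 1 = N 2 1 ∧ M 2 2 = N 2 2) := by
  constructor
  · intro h
    have h' : ∀ i j, M i j = N i j := fun i j => by rw [← bl_blk M, h, bl_blk]
    simp only [h', and_self]
  · rintro ⟨⟨h1, h2, h3⟩, ⟨h4, h5, h6⟩, ⟨h7, h8, h9⟩⟩
    congr 1
    funext i j
    fin_cases i <;> fin_cases j <;> assumption

theorem blk_one : (1 : M6 k) = blk ![![1, 0, 0], ![0, 1, 0], ![0, 0, 1]] := by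
  ext i j
  fin_cases i <;> fin_cases j <;> rfl

/-- Block upper triangular with equal diagonal blocks. -/
def tri (g A B C : M2 k) : M6 k := blk ![![g, A, C], ![0, g, B], ![0, 0, g]]

theorem tri_mul (g A B C g' A' B' C' : M2 k) : tri g A B C * tri g' A' B' C' =
    tri (g * g') (g * A' + A * g') (g * B' + B * g') (g * C' + A * B' + C * g') := by
  unfold tri
  rw [blk_mul, blk_inj]
  simp [Fin.sum_univ_three]

theorem tri_one : (1 : M6 k) = tri 1 0 0 0 := blk_one

theorem Dmat_mul_Umat (g X Y Z : M2 k) :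
    Dmat g * Umat X Y Z = tri g (g * X) (g * Y) (g * Z) := by
  unfold Dmat bdiag Umat tri
  rw [blk_mul, blk_inj]
  simp [Fin.sum_univ_three]

theorem J_conj (g : M2 k) : g * Jmat * gᵀ = g.det • Jmat := by
  ext i j
  fin_cases i <;> fin_cases j <;>
    simp [Jmat, Matrix.mul_apply, Fin.sum_univ_two, Matrix.det_fin_two] <;> ring

theorem Jmat_transpose : (Jmat : M2 k)ᵀ = -Jmat := by
  ext i j
  fin_cases i <;> fin_cases j <;> simp [Jmat]

theorem tri_J3 (g A B C : M2 k) : tri g A B C * J3 * (tri g A B C)ᵀ = g.det • (J3 : M6 k) ↔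
    (A * Jmat * gᵀ + g * Jmat * Bᵀ = 0 ∧ C * Jmat * gᵀ + g * Jmat * Cᵀ = -(A * Jmat * Aᵀ)) := by
  unfold tri J3
  rw [blk_transpose, blk_mul, blk_mul, blk_smul, blk_inj]
  simp [Fin.sum_univ_three, J_conj]
  constructor
  · rintro ⟨⟨h1, h2⟩, h3⟩
    refine ⟨h2, ?_⟩
    rw [eq_neg_iff_add_eq_zero, ← h1]
    abel
  · rintro ⟨h1, h2⟩
    refine ⟨⟨?_, h1⟩, ?_⟩
    · rw [eq_neg_iff_add_eq_zero] at h2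
      rw [← h2]
      abel
    · have := congrArg Matrix.transpose h1
      simp only [Matrix.transpose_add, Matrix.transpose_mul, Matrix.transpose_transpose,
        Matrix.transpose_zero] at this
      rw [Jmat_transpose] at this
      rw [← neg_eq_zero, ← this]
      noncomm_ring

theorem mem_Sgrp {m : M6 k} : m ∈ Sgrp k ↔ ∃ g A B C : M2 k, IsUnit g ∧ m = tri g A B C ∧
    m * J3 * mᵀ = g.det • (J3 : M6 k) := by
  have aux : ∀ (g X Y Z : M2 k), IsUnit g →
      (((g * X) * Jmat * gᵀ + g * Jmat * (g * Y)ᵀ = 0 ∧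
        (g * Z) * Jmat * gᵀ + g * Jmat * (g * Z)ᵀ = -((g * X) * Jmat * (g * X)ᵀ)) ↔
      (X * Jmat + Jmat * Yᵀ = 0 ∧ Z * Jmat + Jmat * Zᵀ = -(X * Jmat * Xᵀ))) := by
    intro g X Y Z hg
    have hgt : IsUnit gᵀ := (Matrix.isUnit_transpose g).mpr hg
    have z : ∀ M : M2 k, g * M * gᵀ = 0 ↔ M = 0 := fun M => by
      rw [hgt.mul_left_eq_zero, hg.mul_right_eq_zero]
    rw [eq_neg_iff_add_eq_zero, eq_neg_iff_add_eq_zero, ← z (X * Jmat + Jmat * Yᵀ),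
      ← z (Z * Jmat + Jmat * Zᵀ + X * Jmat * Xᵀ)]
    simp only [Matrix.transpose_mul, mul_add, add_mul, mul_assoc]
  constructor
  · rintro ⟨_, ⟨g, hg, rfl⟩, _, ⟨X, Y, Z, h1, h2, rfl⟩, rfl⟩
    refine ⟨g, g * X, g * Y, g * Z, hg, Dmat_mul_Umat g X Y Z, ?_⟩
    simp only [Dmat_mul_Umat]
    rw [tri_J3, aux g X Y Z hg]
    exact ⟨h1, h2⟩
  · rintro ⟨g, A, B, C, hg, rfl, h⟩
    have hd := (Matrix.isUnit_iff_isUnit_det g).mp hg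
    have e : ∀ A, g * (g⁻¹ * A) = A := fun A => Matrix.mul_nonsing_inv_cancel_left g A hd
    rw [tri_J3, ← e A, ← e B, ← e C, aux _ _ _ _ hg] at h
    refine ⟨_, ⟨g, hg, rfl⟩, _, ⟨g⁻¹ * A, g⁻¹ * B, g⁻¹ * C, h.1, h.2, rfl⟩, ?_⟩
    simp only [Dmat_mul_Umat, e]

theorem tri_inv (g A B C : M2 k) (hg : IsUnit g) :
    tri g A B C * tri g⁻¹ (-(g⁻¹ * A * g⁻¹)) (-(g⁻¹ * B * g⁻¹))
      (g⁻¹ * A * g⁻¹ * B * g⁻¹ - g⁻¹ * C * g⁻¹) = 1 := by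
  have hd := (Matrix.isUnit_iff_isUnit_det g).mp hg
  have e : ∀ A, g * (g⁻¹ * A) = A := fun A => Matrix.mul_nonsing_inv_cancel_left g A hd
  have e' : g * g⁻¹ = 1 := Matrix.mul_nonsing_inv g hd
  rw [tri_mul, tri_one]
  congr 1
  · simp only [mul_neg, mul_assoc, e]
    simp
  · simp only [mul_neg, mul_assoc, e]
    simp
  · simp only [mul_neg, mul_sub, mul_assoc, e]
    abel

theorem J3_ne_zero : (J3 : M6 k) ≠ 0 := by
  intro h
  have : (J3 : M6 k) 1 4 = 0 := by rw [h]; rfl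
  have h1 : (J3 : M6 k) 1 4 = 1 := rfl
  rw [h1] at this
  exact one_ne_zero this

/-- The Shalika subgroup as a subgroup of the unit group. -/
def ShSub (k : Type*) [Field k] : Subgroup (M6 k)ˣ where
  carrier := {u | (u : M6 k) ∈ Sgrp k}
  mul_mem' := by
    intro a b ha hb
    obtain ⟨g, A, B, C, hg, e, h⟩ := mem_Sgrp.mp ha
    obtain ⟨g', A', B', C', hg', e', h'⟩ := mem_Sgrp.mp hb
    refine mem_Sgrp.mpr ⟨g * g', g * A' + A * g', g * B' + B * g', g * C' + A * B' + C * g', hg.mul hg', ?_, ?_⟩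
    · rw [Units.val_mul, e, e', tri_mul]
    · rw [Units.val_mul, Matrix.transpose_mul]
      calc (a : M6 k) * (b : M6 k) * J3 * ((b : M6 k)ᵀ * (a : M6 k)ᵀ)
          = (a : M6 k) * ((b : M6 k) * J3 * (b : M6 k)ᵀ) * (a : M6 k)ᵀ := by simp only [mul_assoc]
        _ = _ := by
          rw [h', Matrix.mul_smul, Matrix.smul_mul, h, smul_smul, Matrix.det_mul, mul_comm]
  one_mem' := by
    refine mem_Sgrp.mpr ⟨1, 0, 0, 0, isUnit_one, ?_, ?_⟩
    · rw [Units.val_one, tri_one]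
    · simp
  inv_mem' := by
    intro a ha
    obtain ⟨g, A, B, C, hg, e, h⟩ := mem_Sgrp.mp ha
    have hd := (Matrix.isUnit_iff_isUnit_det g).mp hg
    have hi := tri_inv g A B C hg
    rw [← e] at hi
    have hinv := Units.inv_eq_of_mul_eq_one_right hi
    refine mem_Sgrp.mpr ⟨g⁻¹, _, _, _, (Matrix.isUnit_nonsing_inv_iff).mpr hg, hinv, ?_⟩
    have h2 : ((a⁻¹ : (M6 k)ˣ) : M6 k) * ((a : M6 k) * J3 * (a : M6 k)ᵀ) * ((a⁻¹ : (M6 k)ˣ) : M6 k)ᵀ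
        = J3 := by
      have : (a : M6 k)ᵀ * ((a⁻¹ : (M6 k)ˣ) : M6 k)ᵀ = 1 := by
        rw [← Matrix.transpose_mul, Units.inv_mul, Matrix.transpose_one]
      simp only [mul_assoc, this, mul_one]
      rw [Units.inv_mul_cancel_left]
    rw [h, Matrix.mul_smul, Matrix.smul_mul] at h2
    rw [Matrix.det_nonsing_inv, Ring.inverse_eq_inv', eq_inv_smul_iff₀ hd.ne_zero]
    exact h2

theorem mem_Sub {u : (M6 k)ˣ} : u ∈ ShSub k ↔ (u : M6 k) ∈ Sgrp k := Iff.rfl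

theorem isUnit_of_mem_Sgrp {m : M6 k} (hm : m ∈ Sgrp k) : IsUnit m := by
  obtain ⟨g, A, B, C, hg, e, h⟩ := mem_Sgrp.mp hm
  have hi := tri_inv g A B C hg
  rw [← e] at hi
  exact IsUnit.of_mul_eq_one _ hi

theorem exists_Sub {m : M6 k} (hm : m ∈ Sgrp k) : ∃ u : ShSub k, ((u : (M6 k)ˣ) : M6 k) = m := by
  obtain ⟨u, rfl⟩ := isUnit_of_mem_Sgrp hm
  exact ⟨⟨u, hm⟩, rfl⟩

theorem mem_Sub_iff {u : (M6 k)ˣ} : u ∈ ShSub k ↔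
    bl (u : M6 k) 1 0 = 0 ∧ bl (u : M6 k) 2 0 = 0 ∧ bl (u : M6 k) 2 1 = 0 ∧
    bl (u : M6 k) 1 1 = bl (u : M6 k) 0 0 ∧ bl (u : M6 k) 2 2 = bl (u : M6 k) 0 0 ∧
    (u : M6 k) * J3 * (u : M6 k)ᵀ = (bl (u : M6 k) 0 0).det • (J3 : M6 k) := by
  rw [mem_Sub, mem_Sgrp]
  constructor
  · rintro ⟨g, A, B, C, hg, e, h⟩
    have e0 : bl (u : M6 k) 0 0 = g := by rw [e, tri, bl_blk]; rfl
    rw [e0]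
    refine ⟨?_, ?_, ?_, ?_, ?_, h⟩ <;> rw [e, tri, bl_blk] <;> rfl
  · rintro ⟨h1, h2, h3, h4, h5, h6⟩
    refine ⟨bl (u : M6 k) 0 0, bl (u : M6 k) 0 1, bl (u : M6 k) 1 2, bl (u : M6 k) 0 2, ?_, ?_, h6⟩
    · rw [Matrix.isUnit_iff_isUnit_det, isUnit_iff_ne_zero]
      intro h0
      rw [h0, zero_smul] at h6
      have hut : IsUnit (u : M6 k)ᵀ := (Matrix.isUnit_transpose _).mpr u.isUnit
      rw [hut.mul_left_eq_zero, u.isUnit.mul_right_eq_zero] at h6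
      exact J3_ne_zero h6
    · conv_lhs => rw [← blk_bl (u : M6 k)]
      rw [tri, blk_inj]
      simp [h1, h2, h3, h4, h5]

theorem Dmat_one : Dmat (1 : M2 k) = 1 := blk_one.symm
theorem Umat_zero : Umat (0 : M2 k) 0 0 = 1 := blk_one.symm

theorem shalika_apply {ψk : k → ℂˣ} {ψS : M6 k → ℂˣ} (hψS : IsShalikaCharacter ψk ψS)
    {u : (M6 k)ˣ} (hu : u ∈ ShSub k) :
    ψS u = ψk (-(bl ((u⁻¹ : (M6 k)ˣ) : M6 k) 0 0 * bl (u : M6 k) 0 1).trace) := by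
  obtain ⟨d, ⟨g, hg, rfl⟩, v, ⟨X, Y, Z, h1, h2, rfl⟩, e⟩ := id hu
  simp only at e
  have hD : Dmat g ∈ Sgrp k :=
    ⟨_, ⟨g, hg, rfl⟩, 1, ⟨0, 0, 0, by simp, by simp, Umat_zero.symm⟩, by simp⟩
  have hU : Umat X Y Z ∈ Sgrp k :=
    ⟨1, ⟨1, isUnit_one, Dmat_one.symm⟩, _, ⟨X, Y, Z, h1, h2, rfl⟩, by simp⟩
  have e1 : ψS u = ψk (-X.trace) := by
    rw [← e, hψS.1 _ hD _ hU, hψS.2.2 g hg, hψS.2.1 X Y Z h1 h2, one_mul]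
  rw [e1]
  rw [Dmat_mul_Umat] at e
  have hd := (Matrix.isUnit_iff_isUnit_det g).mp hg
  have hi := tri_inv g (g * X) (g * Y) (g * Z) hg
  rw [e] at hi
  rw [Units.inv_eq_of_mul_eq_one_right hi, ← e, tri, tri, bl_blk, bl_blk]
  congr 3
  exact (Matrix.nonsing_inv_mul_cancel_left g X hd).symm

end Algebra

end Concrete
section Topo

open Topology

section General
variable {k : Type*} [Field k] [TopologicalSpace k]

theorem continuous_bl (i j : Fin 3) : Continuous (fun m : M6 k => bl m i j) := by
  unfold bl
  refine continuous_matrix fun a b => ?_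
  simp only [Matrix.of_apply]
  exact (continuous_apply _).comp (continuous_apply _)

theorem m6_lc [LocallyCompactSpace k] : LocallyCompactSpace (M6 k) :=
  inferInstanceAs (LocallyCompactSpace (Fin 6 → Fin 6 → k))

theorem m6_sc [SigmaCompactSpace k] : SigmaCompactSpace (M6 k) :=
  inferInstanceAs (SigmaCompactSpace (Fin 6 → Fin 6 → k))

theorem m6_td [TotallyDisconnectedSpace k] : TotallyDisconnectedSpace (M6 k) :=
  inferInstanceAs (TotallyDisconnectedSpace (Fin 6 → Fin 6 → k))

variable [IsTopologicalRing k] [T2Space k]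

theorem isClosed_ShSub : IsClosed (ShSub k : Set (M6 k)ˣ) := by
  have e : (ShSub k : Set (M6 k)ˣ) = {u : (M6 k)ˣ |
      bl (u : M6 k) 1 0 = 0 ∧ bl (u : M6 k) 2 0 = 0 ∧ bl (u : M6 k) 2 1 = 0 ∧
      bl (u : M6 k) 1 1 = bl (u : M6 k) 0 0 ∧ bl (u : M6 k) 2 2 = bl (u : M6 k) 0 0 ∧
      (u : M6 k) * J3 * (u : M6 k)ᵀ = (bl (u : M6 k) 0 0).det • (J3 : M6 k)} := by
    ext u
    exact mem_Sub_iff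
  rw [e]
  have hv : Continuous (fun u : (M6 k)ˣ => (u : M6 k)) := Units.continuous_val
  have hb : ∀ i j, Continuous (fun u : (M6 k)ˣ => bl (u : M6 k) i j) :=
    fun i j => (continuous_bl i j).comp hv
  refine (isClosed_eq (hb _ _) continuous_const).and ((isClosed_eq (hb _ _) continuous_const).and
    ((isClosed_eq (hb _ _) continuous_const).and ((isClosed_eq (hb _ _) (hb _ _)).and
    ((isClosed_eq (hb _ _) (hb _ _)).and (isClosed_eq ?_ ?_)))))
  · exact (hv.mul continuous_const).mul hv.matrix_transpose
  · exact (hb 0 0).matrix_det.smul continuous_const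

theorem closedEmb_ShSub : IsClosedEmbedding (fun u : ShSub k =>
    Units.embedProduct (M6 k) (u : (M6 k)ˣ)) :=
  Units.isClosedEmbedding_embedProduct.comp isClosed_ShSub.isClosedEmbedding_subtypeVal

theorem sh_lc [LocallyCompactSpace k] : LocallyCompactSpace (ShSub k) := by
  have := m6_lc (k := k)
  have : LocallyCompactSpace (M6 k)ᵐᵒᵖ :=
    (MulOpposite.opHomeomorph (M := M6 k)).symm.isClosedEmbedding.locallyCompactSpace
  exact closedEmb_ShSub.locallyCompactSpace

theorem sh_sc [SigmaCompactSpace k] : SigmaCompactSpace (ShSub k) := by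
  have := m6_sc (k := k)
  have : SigmaCompactSpace (M6 k)ᵐᵒᵖ :=
    (MulOpposite.opHomeomorph (M := M6 k)).symm.isClosedEmbedding.sigmaCompactSpace
  exact closedEmb_ShSub.sigmaCompactSpace

theorem sh_td [TotallyDisconnectedSpace k] : TotallyDisconnectedSpace (ShSub k) := by
  have := m6_td (k := k)
  refine ⟨isTotallyDisconnected_of_image (f := fun u : ShSub k => ((u : (M6 k)ˣ) : M6 k))
    (Units.continuous_val.comp continuous_subtype_val).continuousOn
    (fun a b h => Subtype.ext (Units.ext h)) (isTotallyDisconnected_of_totallyDisconnectedSpace _)⟩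

/-- The two-sided action. -/
@[reducible]
def actX {X : Set (M6 k)} (g : M6 k) (hX : X = setT (Sgrp k) * {g} * Sgrp k) :
    MulAction (ShSub k × ShSub k) {m : M6 k // m ∈ X} where
  smul a x := ⟨(((a.1⁻¹ : ShSub k) : (M6 k)ˣ) : M6 k)ᵀ * x.1 * ((a.2⁻¹ : ShSub k) : (M6 k)ˣ), by
    obtain ⟨x, hx⟩ := x
    refine hX.symm.subset ?_
    rw [hX] at hx
    obtain ⟨_, ⟨_, ⟨s, hs, rfl⟩, _, rfl, rfl⟩, t, ht, rfl⟩ := hx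
    obtain ⟨s, rfl⟩ := exists_Sub hs
    obtain ⟨t, rfl⟩ := exists_Sub ht
    refine ⟨_, ⟨_, ⟨_, (s * a.1⁻¹).2, rfl⟩, _, rfl, rfl⟩, _, (t * a.2⁻¹).2, ?_⟩
    simp [mul_assoc]⟩
  one_smul x := by
    apply Subtype.ext
    change (((1⁻¹ : ShSub k) : (M6 k)ˣ) : M6 k)ᵀ * x.1 * ((1⁻¹ : ShSub k) : (M6 k)ˣ) = x.1
    simp
  mul_smul a b x := by
    apply Subtype.ext
    change ((((a.1 * b.1)⁻¹ : ShSub k) : (M6 k)ˣ) : M6 k)ᵀ * x.1 *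
        (((a.2 * b.2)⁻¹ : ShSub k) : (M6 k)ˣ) =
      (((a.1⁻¹ : ShSub k) : (M6 k)ˣ) : M6 k)ᵀ * ((((b.1⁻¹ : ShSub k) : (M6 k)ˣ) : M6 k)ᵀ * x.1 *
        ((b.2⁻¹ : ShSub k) : (M6 k)ˣ)) * ((a.2⁻¹ : ShSub k) : (M6 k)ˣ)
    simp only [_root_.mul_inv_rev, Subgroup.coe_mul, Units.val_mul, Matrix.transpose_mul, mul_assoc]

theorem vanishing_aux [LocallyCompactSpace k] [SigmaCompactSpace k] [TotallyDisconnectedSpace k]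
    (ψk : k → ℂˣ) (hψk : ∀ x y : k, ψk (x + y) = ψk x * ψk y) (hlc : IsLocallyConstant ψk)
    (hnorm : ∀ x, ‖(ψk x : ℂ)‖ = 1)
    (ψS : M6 k → ℂˣ) (hψS : IsShalikaCharacter ψk ψS)
    (g : M6 k) (hg : g ∈ GSp6 k)
    (X : Set (M6 k)) (hX : X = setT (Sgrp k) * {g} * Sgrp k)
    (hs : ∃ s ∈ Sgrp k, g⁻¹ * sᵀ * g ∈ Sgrp k ∧ ψS ((sᵀ)ᵀ) ≠ ψS (g⁻¹ * sᵀ * g))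
    (T : ({m : M6 k // m ∈ X} → ℂ) → ℂ) (hT : IsInvariantDistrib ψS X T) :
    ∀ f ∈ Cc X, T f = 0 := by
  let := actX g hX
  have smul_def : ∀ (a : ShSub k × ShSub k) (x : {m : M6 k // m ∈ X}), (a • x).1 =
    (((a.1⁻¹ : ShSub k) : (M6 k)ˣ) : M6 k)ᵀ * x.1 * ((a.2⁻¹ : ShSub k) : (M6 k)ˣ) :=
    fun _ _ => rfl
  have := sh_lc (k := k)
  have := sh_sc (k := k)
  have := sh_td (k := k)
  have : ContinuousSMul (ShSub k × ShSub k) {m : M6 k // m ∈ X} := by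
    refine ⟨?_⟩
    rw [continuous_induced_rng]
    change Continuous (fun q : (ShSub k × ShSub k) × {m : M6 k // m ∈ X} =>
      (((q.1.1⁻¹ : ShSub k) : (M6 k)ˣ) : M6 k)ᵀ * q.2.1 * ((q.1.2⁻¹ : ShSub k) : (M6 k)ˣ))
    have hc : Continuous (fun u : ShSub k => ((u⁻¹ : ShSub k) : (M6 k)ˣ).val) :=
      Units.continuous_val.comp (continuous_subtype_val.comp continuous_inv)
    have h1 := (hc.comp (continuous_fst.comp (continuous_fst
      (X := ShSub k × ShSub k) (Y := {m : M6 k // m ∈ X})))).matrix_transpose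
    have h2 := hc.comp (continuous_snd.comp (continuous_fst
      (X := ShSub k × ShSub k) (Y := {m : M6 k // m ∈ X})))
    exact (h1.mul (continuous_subtype_val.comp continuous_snd)).mul h2
  have hgX : g ∈ X := by
    rw [hX]
    exact ⟨_, ⟨_, ⟨1, (1 : ShSub k).2, rfl⟩, _, rfl, rfl⟩, _, (1 : ShSub k).2, by simp⟩
  have : MulAction.IsPretransitive (ShSub k × ShSub k) {m : M6 k // m ∈ X} := by
    suffices H : ∀ x : {m : M6 k // m ∈ X}, ∃ a : ShSub k × ShSub k,
        a • (⟨g, hgX⟩ : {m : M6 k // m ∈ X}) = x by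
      refine ⟨fun x y => ?_⟩
      obtain ⟨a, rfl⟩ := H x
      obtain ⟨b, rfl⟩ := H y
      exact ⟨b * a⁻¹, by rw [mul_smul, inv_smul_smul]⟩
    rintro ⟨x, hx⟩
    have hx2 := hx
    rw [hX] at hx2
    obtain ⟨_, ⟨_, ⟨s1, hs1, rfl⟩, _, rfl, rfl⟩, t, ht, rfl⟩ := hx2
    obtain ⟨s, rfl⟩ := exists_Sub hs1
    obtain ⟨t, rfl⟩ := exists_Sub ht
    refine ⟨(s⁻¹, t⁻¹), Subtype.ext ?_⟩
    rw [smul_def]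
    simp
  let χ₀ : ShSub k →* ℂˣ := MonoidHom.mk' (fun u => ψS (u : (M6 k)ˣ)) (fun a b => by
    simpa using hψS.1 _ a.2 _ b.2)
  have hχ₀ : ∀ᶠ a in 𝓝 (1 : ShSub k), χ₀ a = 1 := by
    have hc : Continuous (fun u : ShSub k =>
        -(bl (((u : (M6 k)ˣ)⁻¹ : (M6 k)ˣ) : M6 k) 0 0 * bl ((u : (M6 k)ˣ) : M6 k) 0 1).trace) := by
      have hu : Continuous (fun u : ShSub k => (u : (M6 k)ˣ)) := continuous_subtype_val
      exact ((((continuous_bl 0 0).comp (Units.continuous_val.comp hu.inv)).mul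
        ((continuous_bl 0 1).comp (Units.continuous_val.comp hu))).matrix_trace).neg
    have := (hlc.comp_continuous hc).eventually_eq 1
    filter_upwards [this] with u hu
    have e1 : χ₀ u = χ₀ 1 := by
      change ψS _ = ψS _
      rw [shalika_apply hψS u.2, shalika_apply hψS (1 : ShSub k).2]
      exact hu
    rw [e1, map_one]
  let χ : ShSub k × ShSub k →* ℂˣ :=
    (χ₀.comp (MonoidHom.fst _ _))⁻¹ * (χ₀.comp (MonoidHom.snd _ _))⁻¹
  have χ_def : ∀ a : ShSub k × ShSub k, χ a = (χ₀ a.1)⁻¹ * (χ₀ a.2)⁻¹ := fun _ => rfl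
  have hχ : ∀ᶠ a in 𝓝 (1 : ShSub k × ShSub k), χ a = 1 := by
    have h1 : ∀ᶠ a in 𝓝 (1 : ShSub k × ShSub k), χ₀ a.1 = 1 :=
      (continuous_fst.tendsto (1 : ShSub k × ShSub k)).eventually hχ₀
    have h2 : ∀ᶠ a in 𝓝 (1 : ShSub k × ShSub k), χ₀ a.2 = 1 :=
      (continuous_snd.tendsto (1 : ShSub k × ShSub k)).eventually hχ₀
    filter_upwards [h1, h2] with a ha hb
    rw [χ_def, ha, hb]
    simp
  have hn0 : ∀ u : ShSub k, ‖(χ₀ u : ℂ)‖ = 1 := fun u => by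
    change ‖(ψS _ : ℂ)‖ = 1
    rw [shalika_apply hψS u.2]
    exact hnorm _
  obtain ⟨s, hsS, htS, hne⟩ := hs
  obtain ⟨s, rfl⟩ := exists_Sub hsS
  obtain ⟨t, ht⟩ := exists_Sub htS
  rw [← ht, Matrix.transpose_transpose] at hne
  refine abstract_vanishing (G := ShSub k × ShSub k) χ hχ hT.1 hT.2.1 ?_ ⟨g, hgX⟩ (s⁻¹, t) ?_ ?_ ?_
  · rintro ⟨a, b⟩ f hf
    have h := hT.2.2 ((((a⁻¹ : ShSub k) : (M6 k)ˣ) : M6 k)ᵀ) ⟨_, (a⁻¹).2, rfl⟩ _ b.2 f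
      (fun x => f ((a, b)⁻¹ • x)) hf ?_ ?_
    · rw [h, Matrix.transpose_transpose, χ_def]
      change ((χ₀ a⁻¹ : ℂˣ) : ℂ) * ((χ₀ b : ℂˣ) : ℂ)⁻¹ * T f = _
      simp
    · refine ⟨hf.1.comp_continuous (continuous_const_smul _), ?_⟩
      exact hf.2.comp_homeomorph (Homeomorph.smul (a, b)⁻¹)
    · intro x hx hx'
      refine congrArg f (Subtype.ext ?_)
      rw [smul_def]
      simp only [Prod.inv_mk, inv_inv]
      congr 2
      symm
      apply Matrix.inv_eq_right_inv
      rw [← Matrix.transpose_mul]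
      simp
  · apply Subtype.ext
    rw [smul_def]
    simp only [inv_inv]
    have hd := (Matrix.isUnit_iff_isUnit_det g).mp hg.1
    have e : (((s : (M6 k)ˣ) : M6 k))ᵀ * g = g * ((t : (M6 k)ˣ) : M6 k) := by
      rw [ht, mul_assoc, Matrix.mul_nonsing_inv_cancel_left g _ hd]
    rw [e, mul_assoc]
    simp
  · rw [χ_def]
    intro h
    apply hne
    simp only [map_inv, inv_inv] at h
    exact mul_inv_eq_one.mp h
  · rw [χ_def]
    simp [hn0]

end General

section Padic
theorem td_k (p : ℕ) [Fact p.Prime] (k : Type*) [NontriviallyNormedField k]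
    [NormedAlgebra ℚ_[p] k] [FiniteDimensional ℚ_[p] k] : TotallyDisconnectedSpace k := by
  have e := (Module.finBasis ℚ_[p] k).equivFunL
  exact ⟨isTotallyDisconnected_of_image (f := e) e.continuous.continuousOn e.injective
    (isTotallyDisconnected_of_totallyDisconnectedSpace _)⟩

theorem norm_psi (p : ℕ) [Fact p.Prime] {k : Type*} [NontriviallyNormedField k]
    [NormedAlgebra ℚ_[p] k] [FiniteDimensional ℚ_[p] k] (ψk : k → ℂˣ) (hψk : ∀ x y : k, ψk (x + y) = ψk x * ψk y)
    (hlc : IsLocallyConstant ψk) (x : k) : ‖(ψk x : ℂ)‖ = 1 := by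
  have h0 : ψk 0 = 1 := by simpa using hψk 0 0
  have hn : ∀ n : ℕ, ψk (n • x) = ψk x ^ n := by
    intro n
    induction n with
    | zero => simpa using h0
    | succ n ih => rw [succ_nsmul, hψk, ih, pow_succ]
  have ht : Filter.Tendsto (fun n : ℕ => ((p : ℚ_[p]) ^ n) • x) Filter.atTop (𝓝 0) := by
    have : Filter.Tendsto (fun n : ℕ => ((p : ℚ_[p]) ^ n)) Filter.atTop (𝓝 0) :=
      tendsto_pow_atTop_nhds_zero_of_norm_lt_one Padic.norm_p_lt_one
    simpa using this.smul_const x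
  obtain ⟨n, hn'⟩ := (ht.eventually (hlc.eventually_eq 0)).exists
  have e : ((p : ℚ_[p]) ^ n) • x = (p ^ n) • x := by
    rw [← Nat.cast_pow, Nat.cast_smul_eq_nsmul]
  rw [e, hn, h0] at hn'
  refine Complex.norm_eq_one_of_pow_eq_one (n := p ^ n) ?_ (pow_ne_zero _ (Fact.out : p.Prime).ne_zero)
  have := congrArg (fun u : ℂˣ => (u : ℂ)) hn'
  simpa using this

end Padic

end Topo

/-- Vanishing criterion R2.  Let `g ∈ GSp6(k)` and `X = Sᵀ·g·S`.  If there
exists `s ∈ S` with `g⁻¹·sᵀ·g ∈ S` and `ψ_Sᵀ(sᵀ) ≠ ψ_S(g⁻¹·sᵀ·g)`, then every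
`(S,ψ,T)`-invariant distribution on `X` vanishes on `C_c^∞(X)`. -/
theorem invariant_distribution_vanishes_R2
    {p : ℕ} [Fact p.Prime] {k : Type*} [NontriviallyNormedField k]
    [NormedAlgebra ℚ_[p] k] [FiniteDimensional ℚ_[p] k]
    (ψk : k → ℂˣ) (hψk : ∀ x y : k, ψk (x + y) = ψk x * ψk y)
    (hnt : ∃ x : k, ψk x ≠ 1) (hlc : IsLocallyConstant ψk)
    (ψS : M6 k → ℂˣ) (hψS : IsShalikaCharacter ψk ψS)
    (g : M6 k) (hg : g ∈ GSp6 k)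
    (X : Set (M6 k)) (hX : X = setT (Sgrp k) * {g} * Sgrp k)
    (hs : ∃ s ∈ Sgrp k, g⁻¹ * sᵀ * g ∈ Sgrp k ∧ ψS ((sᵀ)ᵀ) ≠ ψS (g⁻¹ * sᵀ * g))
    (T : ({m : M6 k // m ∈ X} → ℂ) → ℂ) (hT : IsInvariantDistrib ψS X T) :
    ∀ f ∈ Cc X, T f = 0 := by
  have : ProperSpace k := FiniteDimensional.proper ℚ_[p] k
  have : TotallyDisconnectedSpace k := td_k p k
  exact vanishing_aux ψk hψk hlc (norm_psi p ψk hψk hlc) ψS hψS g hg X hX hs T hT
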